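/- arXiv:1511.03247 — 3 statements merged into one kernel-verified Lean document; each statement's English description precedes it below -/
import Mathlib

section
/- For all integers m ≥ 2 and j with 1 ≤ j ≤ m−1, one has |γ_{m,j}| · j < 2·m^{2m+1}·(m−j)^{j−m−1/2}·(m+j)^{−m−j−1/2}. -/
/-- The coefficients `γ_{m,j} := (−1)^{j−1} · (2/j) · C(2m, m+j) / C(2m, m)`. -/
noncomputable def altGamma (m j : ℕ) : ℝ :=
  (-1 : ℝ) ^ (j - 1) * (2 / (j : ℝ)) * ((2 * m).choose (m + j) : ℝ) / ((2 * m).choose m : ℝ)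

theorem ags_d_lt (n k : ℕ) (h : n < k) :
    Real.log (Stirling.stirlingSeq (k + 1)) - Real.log (Stirling.stirlingSeq (k + 2)) <
      Real.log (Stirling.stirlingSeq (n + 1)) - Real.log (Stirling.stirlingSeq (n + 2)) := by
  have hk := Stirling.log_stirlingSeq_sdiff_hasSum k
  have hn := Stirling.log_stirlingSeq_sdiff_hasSum n
  have hc : (n : ℝ) < k := by exact_mod_cast h
  have h0 : (0 : ℝ) ≤ n := by positivity
  have key : (1 : ℝ) / (2 * ((k + 1 : ℕ) : ℝ) + 1) < 1 / (2 * ((n + 1 : ℕ) : ℝ) + 1) := by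
    push_cast
    apply one_div_lt_one_div_of_lt <;> linarith
  have kp : (0 : ℝ) ≤ 1 / (2 * ((k + 1 : ℕ) : ℝ) + 1) := by positivity
  refine hasSum_lt (i := 0) ?_ ?_ hk hn
  · intro i
    try dsimp only
    gcongr
  · try dsimp only
    gcongr

theorem ags_conv (j : ℕ) : ∀ a : ℕ,
    2 * Real.log (Stirling.stirlingSeq (a + j + 2)) <
      Real.log (Stirling.stirlingSeq (a + 2 * j + 3)) +
        Real.log (Stirling.stirlingSeq (a + 1)) := by
  induction j with
  | zero =>
    intro a
    have := ags_d_lt a (a + 1) (by omega)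
    simp only [mul_zero, add_zero, add_assoc] at *
    norm_num at *
    linarith
  | succ j ih =>
    intro a
    have h1 := ih (a + 1)
    have h2 := ags_d_lt a (a + 2 * j + 3) (by omega)
    rw [show a + 1 + j + 2 = a + (j + 1) + 2 by ring,
      show a + 1 + 2 * j + 3 = a + 2 * j + 3 + 1 by ring, show a + 1 + 1 = a + 2 by ring] at h1
    rw [show a + 2 * (j + 1) + 3 = a + 2 * j + 3 + 2 by ring]
    linarith

theorem ags_log_fact (n : ℕ) (hn : n ≠ 0) : Real.log (n.factorial : ℝ) =
    Real.log (Stirling.stirlingSeq n) + 1 / 2 * Real.log 2 + 1 / 2 * Real.log n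
      + n * Real.log n - n := by
  have hn' : (n : ℝ) ≠ 0 := by exact_mod_cast hn
  rw [Stirling.log_stirlingSeq_formula, Real.log_mul (by norm_num) hn',
    Real.log_div hn' (Real.exp_ne_zero _), Real.log_exp]
  ring

theorem ags_abs (m j : ℕ) (hj1 : 1 ≤ j) (hj2 : j ≤ m) :
    |altGamma m j| * (j : ℝ) =
      2 * (m.factorial : ℝ) ^ 2 / (((m + j).factorial : ℝ) * ((m - j).factorial : ℝ)) := by
  have hj : (0 : ℝ) < j := by exact_mod_cast hj1
  unfold altGamma
  rw [Nat.cast_choose ℝ (show m + j ≤ 2 * m by omega), Nat.cast_choose ℝ (show m ≤ 2 * m by omega),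
    show 2 * m - (m + j) = m - j by omega, show 2 * m - m = m by omega,
    abs_div, abs_mul, abs_mul, abs_pow, abs_neg, abs_one, one_pow, one_mul,
    abs_of_nonneg (by positivity), abs_of_nonneg (by positivity), abs_of_nonneg (by positivity)]
  have h1 : ((2 * m).factorial : ℝ) ≠ 0 := by positivity
  have h2 : (m.factorial : ℝ) ≠ 0 := by positivity
  have h3 : ((m + j).factorial : ℝ) ≠ 0 := by positivity
  have h4 : ((m - j).factorial : ℝ) ≠ 0 := by positivity
  field_simp

theorem alt_gamma_stirling_bound (m j : ℕ) (hm : 2 ≤ m) (hj1 : 1 ≤ j) (hj2 : j ≤ m - 1) :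
    |altGamma m j| * (j : ℝ) <
      2 * (m : ℝ) ^ (2 * m + 1) * ((m : ℝ) - (j : ℝ)) ^ ((j : ℝ) - (m : ℝ) - 1 / 2) *
        ((m : ℝ) + (j : ℝ)) ^ (-(m : ℝ) - (j : ℝ) - 1 / 2) := by
  rw [ags_abs m j hj1 (by omega)]
  have hc := ags_conv (j - 1) (m - j - 1)
  rw [show m - j - 1 + (j - 1) + 2 = m by omega, show m - j - 1 + 2 * (j - 1) + 3 = m + j by omega,
    show m - j - 1 + 1 = m - j by omega] at hc
  have hm0 : (0 : ℝ) < m := by exact_mod_cast (by omega : 0 < m)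
  have hj0 : (0 : ℝ) < j := by exact_mod_cast hj1
  have hcast : ((m - j : ℕ) : ℝ) = (m : ℝ) - j := Nat.cast_sub (by omega)
  have hmj : (0 : ℝ) < (m : ℝ) - j := by
    rw [← hcast]; exact_mod_cast (by omega : 0 < m - j)
  have hpj : (0 : ℝ) < (m : ℝ) + j := by linarith
  have f1 := ags_log_fact m (by omega)
  have f2 := ags_log_fact (m + j) (by omega)
  have f3 := ags_log_fact (m - j) (by omega)
  rw [hcast] at f3
  push_cast at f2
  have e1 := Real.rpow_pos_of_pos hmj ((j : ℝ) - (m : ℝ) - 1 / 2)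
  have e2 := Real.rpow_pos_of_pos hpj (-(m : ℝ) - (j : ℝ) - 1 / 2)
  have h2 : (m.factorial : ℝ) ≠ 0 := by positivity
  have h3 : ((m + j).factorial : ℝ) ≠ 0 := by positivity
  have h4 : ((m - j).factorial : ℝ) ≠ 0 := by positivity
  rw [← Real.log_lt_log_iff (by positivity) (by positivity),
    Real.log_div (by positivity) (by positivity), Real.log_mul h3 h4,
    Real.log_mul (by norm_num) (by positivity), Real.log_pow,
    Real.log_mul (by positivity) e2.ne', Real.log_mul (by positivity) e1.ne',
    Real.log_mul (by norm_num) (by positivity), Real.log_pow, Real.log_rpow hmj,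
    Real.log_rpow hpj, f1, f2, f3]
  push_cast
  nlinarith [hc]
end

section
/- Let m₀ ≥ 1 and m ≥ m₀ be integers, and let f : ℝ → ℝ be 2m-times continuously differentiable. Suppose that f^{(2m₀−1)}(x) → 0 as x → ∞, and that the series ∑_{k=0}^{∞} f^{(2m)}(k+w) converges uniformly in w ∈ [−m/2, m/2]. Let F be any antiderivative of f. Then the limit lim_{n→∞} ( ∑_{k=0}^{n−1} f(k) − G_{m₀,F}(n) ) exists and equals −G_{m,F}(0) − R_{m,f}(∞), where R_{m,f}(∞) := (1/((2m−1)!·2^{2m+1})) · ∫_0^1 (1−s)^{2m−1} (∫_{−1}^{1} v^{2m} · ∑_{j=1}^{m} γ_{m,j} j^{2m+1} · (∑_{k=0}^{∞} f^{(2m)}(k + j·s·v/2)) dv) ds. -/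
/-- `G_{m,F}(x) := ∑_{j=1}^m γ_{m,j} ∑_{i=0}^{j−1} F(x−1+j/2−i)`. -/
noncomputable def altG (m : ℕ) (F : ℝ → ℝ) (x : ℝ) : ℝ :=
  ∑ j ∈ Finset.Icc 1 m, altGamma m j *
    ∑ i ∈ Finset.range j, F (x - 1 + (j : ℝ) / 2 - (i : ℝ))

lemma altGamma_moment (m α : ℕ) (h : α < m) :
    ∑ j ∈ Finset.Icc 1 m, altGamma m j * (j : ℝ) ^ (2 * α + 1) = if α = 0 then 1 else 0 := by
  have h0 := congrFun (fwdDiff_iter_pow_eq_zero_of_lt (R := ℝ) (show 2 * α < 2 * m by omega)) (-(m : ℝ))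
  rw [fwdDiff_iter_eq_sum_shift, show 2 * m + 1 = m + (m + 1) by ring, Finset.sum_range_add,
    Finset.sum_range_succ', ← Finset.sum_range_reflect] at h0
  have hC : ((2 * m).choose m : ℝ) ≠ 0 := by
    exact_mod_cast (Nat.choose_pos (by omega)).ne'
  have hI : ∑ j ∈ Finset.Icc 1 m, altGamma m j * (j : ℝ) ^ (2 * α + 1)
      = ∑ k ∈ Finset.range m, altGamma m (1 + k) * ((1 + k : ℕ) : ℝ) ^ (2 * α + 1) := by
    rw [show Finset.Icc 1 m = Finset.Ico 1 (m + 1) by ext; simp,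
      Finset.sum_Ico_eq_sum_range]
    simp
  have hS : ∀ k ∈ Finset.range m, altGamma m (1 + k) * ((1 + k : ℕ) : ℝ) ^ (2 * α + 1) =
      2 * ((-1) ^ k * ((2 * m).choose (m + (1 + k)) : ℝ) * ((1 + k : ℕ) : ℝ) ^ (2 * α)) /
        ((2 * m).choose m : ℝ) := by
    intro k _
    unfold altGamma
    have : ((1 + k : ℕ) : ℝ) ≠ 0 := by positivity
    rw [pow_succ, show 1 + k - 1 = k by omega]
    field_simp
  rw [hI, Finset.sum_congr rfl hS, ← Finset.sum_div, ← Finset.mul_sum]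
  set T := ∑ k ∈ Finset.range m, ((-1) ^ k * ((2 * m).choose (m + (1 + k)) : ℝ) * ((1 + k : ℕ) : ℝ) ^ (2 * α)) with hT
  have e1 : ∑ j ∈ Finset.range m, ((-1 : ℤ) ^ (2 * m - (m - 1 - j)) * ((2 * m).choose (m - 1 - j) : ℤ)) •
      (-(m : ℝ) + (m - 1 - j) • (1 : ℝ)) ^ (2 * α) = (-1) ^ (m + 1) * T := by
    rw [hT, Finset.mul_sum]
    refine Finset.sum_congr rfl fun k hk => ?_
    rw [Finset.mem_range] at hk
    obtain ⟨d, rfl⟩ : ∃ d, m = k + 1 + d := ⟨m - k - 1, by omega⟩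
    have c1 : (2 * (k + 1 + d)).choose (k + 1 + d - 1 - k) = (2 * (k + 1 + d)).choose (k + 1 + d + (1 + k)) := by
      apply Nat.choose_symm_of_eq_add; omega
    rw [c1, show k + 1 + d - 1 - k = d by omega,
      show 2 * (k + 1 + d) - d = (k + 1 + d + 1 + k) by omega, pow_mul, pow_mul _ 2 α]
    rw [show (-((k + 1 + d : ℕ) : ℝ) + d • (1 : ℝ)) ^ 2 = ((1 + k : ℕ) : ℝ) ^ 2 by push_cast; ring]
    rw [zsmul_eq_mul, pow_add _ _ k]
    push_cast
    ring
  have e2 : ∑ k ∈ Finset.range m, ((-1 : ℤ) ^ (2 * m - (m + (k + 1))) * ((2 * m).choose (m + (k + 1)) : ℤ)) •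
      (-(m : ℝ) + (m + (k + 1)) • (1 : ℝ)) ^ (2 * α) = (-1) ^ (m + 1) * T := by
    rw [hT, Finset.mul_sum]
    refine Finset.sum_congr rfl fun k hk => ?_
    rw [Finset.mem_range] at hk
    obtain ⟨d, rfl⟩ : ∃ d, m = k + 1 + d := ⟨m - k - 1, by omega⟩
    rw [show 2 * (k + 1 + d) - (k + 1 + d + (k + 1)) = d by omega, add_comm 1 k]
    rw [show (-((k + 1 + d : ℕ) : ℝ) + (k + 1 + d + (k + 1)) • (1 : ℝ)) = ((k + 1 : ℕ) : ℝ) by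
      simp only [nsmul_eq_mul, mul_one]; push_cast; ring]
    rw [zsmul_eq_mul, show k + 1 + d + 1 = d + 2 * 1 + k by ring, pow_add _ _ k, pow_add _ d]
    have : ((-1 : ℝ) ^ k) * (-1) ^ k = 1 := by rw [← mul_pow]; simp
    push_cast
    linear_combination (- (-1) ^ d * (2 * (k + 1 + d)).choose (k + 1 + d + (k + 1)) * (k + 1 : ℝ) ^ (2 * α)) * this
  rw [e1, e2, show 2 * m - (m + 0) = m by omega] at h0
  simp only [add_zero, zsmul_eq_mul, nsmul_eq_mul, mul_one, neg_add_cancel, Pi.zero_apply] at h0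
  push_cast at h0
  have hp : ((-1 : ℝ) ^ m) * (-1) ^ m = 1 := by rw [← mul_pow]; simp
  rw [div_eq_iff hC]
  have h1 : 2 * T = ((2 * m).choose m : ℝ) * 0 ^ (2 * α) := by
    rw [pow_succ] at h0
    linear_combination (- (-1) ^ m) * h0 + (((2 * m).choose m : ℝ) * 0 ^ (2 * α) - 2 * T) * hp
  rw [h1]
  split_ifs with ha
  · simp [ha]
  · simp [ha]

lemma taylor01 (n : ℕ) (f : ℝ → ℝ) (hf : ContDiff ℝ (n + 1 : ℕ) f) (u : ℝ) :
    f u = ∑ i ∈ Finset.range (n + 1), iteratedDeriv i f 0 / (i.factorial : ℝ) * u ^ i +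
      u ^ (n + 1) / (n.factorial : ℝ) *
        ∫ s in (0 : ℝ)..1, (1 - s) ^ n * iteratedDeriv (n + 1) f (s * u) := by
  have key : ∀ k : ℕ, ContDiff ℝ (k + 1 : ℕ) f → ∀ s : ℝ,
      HasDerivAt (fun s => iteratedDeriv k f (s * u)) (u * iteratedDeriv (k + 1) f (s * u)) s := by
    intro k hk s
    have h1 : HasDerivAt (iteratedDeriv k f) (iteratedDeriv (k + 1) f (s * u)) (s * u) := by
      rw [iteratedDeriv_succ]
      exact (hk.differentiable_iteratedDeriv k (by exact_mod_cast Nat.lt_succ_self k) _).hasDerivAt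
    have h2 : HasDerivAt (fun s : ℝ => s * u) u s := by
      simpa using (hasDerivAt_id s).mul_const u
    have := h1.comp s h2
    rw [mul_comm]
    exact this
  induction n with
  | zero =>
    have hc : Continuous (iteratedDeriv 1 f) := hf.continuous_iteratedDeriv 1 (by simp)
    have := intervalIntegral.integral_eq_sub_of_hasDerivAt (a := 0) (b := 1)
      (f := fun s => iteratedDeriv 0 f (s * u)) (fun s _ => key 0 hf s)
      (Continuous.intervalIntegrable (by fun_prop) _ _)
    rw [intervalIntegral.integral_const_mul] at this
    simp at this
    simp
    linarith
  | succ n ih =>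
    have hf' : ContDiff ℝ (n + 1 : ℕ) f := hf.of_le (by exact_mod_cast Nat.le_succ _)
    have hc : Continuous (iteratedDeriv (n + 1) f) := hf'.continuous_iteratedDeriv _ (by simp)
    have hc2 : Continuous (iteratedDeriv (n + 1 + 1) f) := hf.continuous_iteratedDeriv _ (by simp)
    have hn : (n + 1 : ℝ) ≠ 0 := by positivity
    have hu : ∀ s : ℝ, HasDerivAt (fun s : ℝ => -((1 - s) ^ (n + 1) / (n + 1 : ℝ))) ((1 - s) ^ n) s := by
      intro s
      have := ((((hasDerivAt_id s).const_sub 1).pow (n + 1)).div_const (n + 1 : ℝ)).neg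
      convert! this using 1
      simp
      field_simp
    have := intervalIntegral.integral_mul_deriv_eq_deriv_mul (a := 0) (b := 1)
      (fun s _ => hu s) (fun s _ => key (n + 1) hf s)
      (Continuous.intervalIntegrable (by fun_prop) _ _)
      (Continuous.intervalIntegrable (by fun_prop) _ _)
    have h3 : ∫ s in (0 : ℝ)..1, -((1 - s) ^ (n + 1) / (n + 1 : ℝ)) * (u * iteratedDeriv (n + 1 + 1) f (s * u))
        = (-(u / (n + 1 : ℝ))) * ∫ s in (0 : ℝ)..1, (1 - s) ^ (n + 1) * iteratedDeriv (n + 1 + 1) f (s * u) := by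
      rw [← intervalIntegral.integral_const_mul]
      congr 1; ext s; ring
    rw [h3] at this
    simp at this
    rw [Finset.sum_range_succ]
    refine (ih hf').trans ?_
    rw [add_assoc]
    congr 1
    have hfac : (n.factorial : ℝ) ≠ 0 := by positivity
    rw [Nat.factorial_succ]
    push_cast
    set A := ∫ s in (0 : ℝ)..1, (1 - s) ^ n * iteratedDeriv (n + 1) f (s * u)
    set B := ∫ s in (0 : ℝ)..1, (1 - s) ^ (n + 1) * iteratedDeriv (n + 1 + 1) f (s * u)
    have hA : A = (n + 1 : ℝ)⁻¹ * iteratedDeriv (n + 1) f 0 + u / (n + 1) * B := by linarith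
    rw [hA]
    field_simp
    ring

lemma altG_step (m : ℕ) (F : ℝ → ℝ) (x : ℝ) :
    altG m F (x + 1) - altG m F x =
      ∑ j ∈ Finset.Icc 1 m, altGamma m j * (F (x + (j : ℝ) / 2) - F (x - (j : ℝ) / 2)) := by
  unfold altG
  rw [← Finset.sum_sub_distrib]
  refine Finset.sum_congr rfl fun j _ => ?_
  rw [← mul_sub, ← Finset.sum_sub_distrib]
  congr 1
  have := Finset.sum_range_sub' (fun i : ℕ => F (x + (j : ℝ) / 2 - i)) j
  rw [show F (x + (j : ℝ) / 2) - F (x - (j : ℝ) / 2) =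
    F (x + (j : ℝ) / 2 - (0 : ℕ)) - F (x + (j : ℝ) / 2 - j) by
      congr 2
      · simp
      · ring, ← this]
  refine Finset.sum_congr rfl fun i _ => ?_
  push_cast
  congr 2 <;> ring

noncomputable def altR (m : ℕ) (h : ℝ → ℝ) : ℝ :=
  ∫ s in (0 : ℝ)..1, (1 - s) ^ (2 * m - 1) *
    ∫ v in (-1 : ℝ)..1, v ^ (2 * m) *
      ∑ j ∈ Finset.Icc 1 m, altGamma m j * (j : ℝ) ^ (2 * m + 1) * h ((j : ℝ) * s * v / 2)

lemma altR_eq (m : ℕ) (h : ℝ → ℝ) (hh : Continuous h) :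
    altR m h = ∑ j ∈ Finset.Icc 1 m, altGamma m j * (j : ℝ) ^ (2 * m + 1) *
      ∫ v in (-1 : ℝ)..1, v ^ (2 * m) * ∫ s in (0 : ℝ)..1, (1 - s) ^ (2 * m - 1) *
        h (s * ((j : ℝ) / 2 * v)) := by
  have hj : ∀ j : ℕ, ∫ v in (-1 : ℝ)..1, v ^ (2 * m) * ∫ s in (0 : ℝ)..1, (1 - s) ^ (2 * m - 1) *
        h (s * ((j : ℝ) / 2 * v)) = ∫ s in (0 : ℝ)..1, ∫ v in (-1 : ℝ)..1,
          v ^ (2 * m) * ((1 - s) ^ (2 * m - 1) * h (s * ((j : ℝ) / 2 * v))) := by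
    intro j
    rw [MeasureTheory.intervalIntegral_intervalIntegral_swap]
    · simp_rw [intervalIntegral.integral_const_mul]
    · have hc : Continuous (Function.uncurry fun s v : ℝ =>
          v ^ (2 * m) * ((1 - s) ^ (2 * m - 1) * h (s * ((j : ℝ) / 2 * v)))) := by
        unfold Function.uncurry; fun_prop
      refine (hc.continuousOn.integrableOn_compact
        (isCompact_uIcc (a := (0 : ℝ)) (b := 1) |>.prod (isCompact_uIcc (a := (-1 : ℝ)) (b := 1)))).mono_set ?_
      exact Set.prod_mono Set.uIoc_subset_uIcc Set.uIoc_subset_uIcc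
  simp_rw [hj, ← intervalIntegral.integral_const_mul]
  rw [← intervalIntegral.integral_finsetSum]
  · unfold altR
    refine intervalIntegral.integral_congr fun s _ => ?_
    beta_reduce
    rw [← intervalIntegral.integral_const_mul, ← intervalIntegral.integral_finsetSum]
    · refine intervalIntegral.integral_congr fun v _ => ?_
      beta_reduce
      rw [Finset.mul_sum, Finset.mul_sum]
      refine Finset.sum_congr rfl fun j _ => ?_
      rw [show (j : ℝ) * s * v / 2 = s * ((j : ℝ) / 2 * v) by ring]
      ring
    · intro j _
      exact Continuous.intervalIntegrable (by fun_prop) _ _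
  · intro j _
    apply Continuous.intervalIntegrable
    apply intervalIntegral.continuous_parametric_intervalIntegral_of_continuous'
    unfold Function.uncurry
    fun_prop

lemma alt_onestep (m : ℕ) (hm : 1 ≤ m) (f F : ℝ → ℝ) (hf : ContDiff ℝ (2 * m : ℕ) f)
    (hF : ∀ x : ℝ, HasDerivAt F (f x) x) :
    ∑ j ∈ Finset.Icc 1 m, altGamma m j * (F ((j : ℝ) / 2) - F (-((j : ℝ) / 2))) =
      f 0 + 1 / (((2 * m - 1).factorial : ℝ) * 2 ^ (2 * m + 1)) *
        altR m (iteratedDeriv (2 * m) f) := by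
  have hc : Continuous (iteratedDeriv (2 * m) f) := hf.continuous_iteratedDeriv _ le_rfl
  have hfc : Continuous f := hf.continuous
  set h := iteratedDeriv (2 * m) f with hh
  have hI : Continuous fun u : ℝ => ∫ s in (0 : ℝ)..1, (1 - s) ^ (2 * m - 1) * h (s * u) := by
    apply intervalIntegral.continuous_parametric_intervalIntegral_of_continuous'
    unfold Function.uncurry
    fun_prop
  have hT : ∀ u, f u = ∑ i ∈ Finset.range (2 * m), iteratedDeriv i f 0 / (i.factorial : ℝ) * u ^ i +
      u ^ (2 * m) / ((2 * m - 1).factorial : ℝ) *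
        ∫ s in (0 : ℝ)..1, (1 - s) ^ (2 * m - 1) * h (s * u) := by
    intro u
    have := taylor01 (2 * m - 1) f (by rwa [show 2 * m - 1 + 1 = 2 * m by omega]) u
    rwa [show 2 * m - 1 + 1 = 2 * m by omega] at this
  have hdiff : ∀ c : ℝ, F c - F (-c) =
      ∑ i ∈ Finset.range (2 * m), iteratedDeriv i f 0 / (i.factorial : ℝ) * c ^ (i + 1) *
        ((1 - (-1) ^ (i + 1)) / (i + 1)) +
      c ^ (2 * m + 1) / ((2 * m - 1).factorial : ℝ) * ∫ v in (-1 : ℝ)..1, v ^ (2 * m) *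
        ∫ s in (0 : ℝ)..1, (1 - s) ^ (2 * m - 1) * h (s * (c * v)) := by
    intro c
    have hd : ∀ v : ℝ, HasDerivAt (fun v => F (c * v)) (c * f (c * v)) v := by
      intro v
      have h2 : HasDerivAt (fun v : ℝ => c * v) c v := by
        simpa using (hasDerivAt_id v).const_mul c
      rw [mul_comm c (f _)]
      exact (hF (c * v)).comp v h2
    have h1 := intervalIntegral.integral_eq_sub_of_hasDerivAt (a := -1) (b := 1)
      (fun v _ => hd v) (Continuous.intervalIntegrable (by fun_prop) _ _)
    rw [show F c - F (-c) = F (c * 1) - F (c * -1) by simp, ← h1]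
    have h2 : ∀ v, c * f (c * v) = ∑ i ∈ Finset.range (2 * m),
        (iteratedDeriv i f 0 / (i.factorial : ℝ) * c ^ (i + 1)) * v ^ i +
        c ^ (2 * m + 1) / ((2 * m - 1).factorial : ℝ) * (v ^ (2 * m) *
        ∫ s in (0 : ℝ)..1, (1 - s) ^ (2 * m - 1) * h (s * (c * v))) := by
      intro v
      rw [hT (c * v), mul_add, Finset.mul_sum]
      congr 1
      · refine Finset.sum_congr rfl fun i _ => ?_
        ring
      · ring
    simp_rw [h2]
    have hIc : Continuous fun v : ℝ => ∫ s in (0 : ℝ)..1, (1 - s) ^ (2 * m - 1) * h (s * (c * v)) :=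
      hI.comp (continuous_const.mul continuous_id)
    rw [intervalIntegral.integral_add, intervalIntegral.integral_finsetSum,
      intervalIntegral.integral_const_mul]
    · congr 1
      refine Finset.sum_congr rfl fun i _ => ?_
      rw [intervalIntegral.integral_const_mul, integral_pow]
      simp
    · intro i _
      exact Continuous.intervalIntegrable (by fun_prop) _ _
    · exact Continuous.intervalIntegrable (by fun_prop) _ _
    · exact Continuous.intervalIntegrable ((continuous_const).mul ((continuous_pow _).mul hIc)) _ _
  simp_rw [hdiff, mul_add, Finset.sum_add_distrib]
  congr 1
  · simp_rw [Finset.mul_sum]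
    rw [Finset.sum_comm]
    rw [Finset.sum_eq_single 0]
    · have h1 := altGamma_moment m 0 (by omega)
      simp only [if_true, mul_zero, zero_add, pow_one] at h1
      have : ∀ j ∈ Finset.Icc 1 m, altGamma m j * (iteratedDeriv 0 f 0 / (Nat.factorial 0 : ℝ) *
          ((j : ℝ) / 2) ^ (0 + 1) * ((1 - (-1) ^ (0 + 1)) / ((0 : ℕ) + 1))) =
          f 0 * (altGamma m j * j) := by
        intro j _
        simp
        ring
      rw [Finset.sum_congr rfl this, ← Finset.mul_sum, h1, mul_one]
    · intro i hi hi0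
      rw [Finset.mem_range] at hi
      rcases Nat.even_or_odd' i with ⟨α, rfl | rfl⟩
      · have h1 := altGamma_moment m α (by omega)
        rw [if_neg (by omega)] at h1
        have : ∀ j ∈ Finset.Icc 1 m, altGamma m j * (iteratedDeriv (2 * α) f 0 / ((2 * α).factorial : ℝ) *
          ((j : ℝ) / 2) ^ (2 * α + 1) * ((1 - (-1) ^ (2 * α + 1)) / ((2 * α : ℕ) + 1))) =
          (iteratedDeriv (2 * α) f 0 / ((2 * α).factorial : ℝ) / 2 ^ (2 * α + 1) *
            ((1 - (-1) ^ (2 * α + 1)) / ((2 * α : ℕ) + 1))) * (altGamma m j * j ^ (2 * α + 1)) := by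
          intro j _
          rw [div_pow]
          ring
        rw [Finset.sum_congr rfl this, ← Finset.mul_sum, h1, mul_zero]
      · apply Finset.sum_eq_zero
        intro j _
        have : (-1 : ℝ) ^ (2 * α + 1 + 1) = 1 := by
          rw [show 2 * α + 1 + 1 = 2 * (α + 1) by ring, pow_mul]; simp
        rw [this]; simp
    · intro h; simp at h; omega
  · rw [altR_eq m h hc, Finset.mul_sum]
    refine Finset.sum_congr rfl fun j _ => ?_
    rw [div_pow]
    ring

lemma altR_tendsto (m : ℕ) (S : ℕ → ℝ → ℝ) (hS : ∀ n, Continuous (S n)) (g : ℝ → ℝ)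
    (hg : TendstoUniformlyOn S g Filter.atTop (Set.Icc (-(m : ℝ) / 2) ((m : ℝ) / 2))) :
    Filter.Tendsto (fun n => altR m (S n)) Filter.atTop (nhds (altR m g)) := by
  have hgc : ContinuousOn g (Set.Icc (-(m : ℝ) / 2) ((m : ℝ) / 2)) :=
    hg.continuousOn (Filter.Eventually.of_forall fun n => (hS n).continuousOn).frequently
  obtain ⟨C, hC⟩ := isCompact_Icc.exists_bound_of_continuousOn hgc
  have hmem : ∀ j ∈ Finset.Icc 1 m, ∀ s ∈ Set.uIoc (0 : ℝ) 1, ∀ v ∈ Set.uIoc (-1 : ℝ) 1,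
      (j : ℝ) * s * v / 2 ∈ Set.Icc (-(m : ℝ) / 2) ((m : ℝ) / 2) := by
    intro j hj s hs v hv
    rw [Set.uIoc_of_le (by norm_num)] at hs hv
    have hj' : (j : ℝ) ≤ m := by exact_mod_cast (Finset.mem_Icc.1 hj).2
    have h0 : (0 : ℝ) ≤ j := by positivity
    have h1 : |(j : ℝ) * s * v| ≤ m := by
      rw [abs_mul, abs_mul, abs_of_nonneg h0, abs_of_nonneg hs.1.le]
      have : |v| ≤ 1 := abs_le.2 ⟨hv.1.le, hv.2⟩
      calc (j : ℝ) * s * |v| ≤ m * 1 * 1 := by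
            have := hs.1.le
            have := hs.2
            gcongr
        _ = m := by ring
    have := abs_le.1 h1
    constructor <;> linarith [this.1, this.2]
  have hbd : ∀ᶠ n in Filter.atTop, ∀ w ∈ Set.Icc (-(m : ℝ) / 2) ((m : ℝ) / 2), |S n w| ≤ C + 1 := by
    filter_upwards [Metric.tendstoUniformlyOn_iff.1 hg 1 one_pos] with n hn w hw
    have h1 := hn w hw
    have h2 := hC w hw
    rw [Real.dist_eq, abs_lt] at h1
    rw [Real.norm_eq_abs, abs_le] at h2
    rw [abs_le]
    constructor <;> linarith [h1.1, h1.2, h2.1, h2.2]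
  set B : ℝ := ∑ j ∈ Finset.Icc 1 m, |altGamma m j * (j : ℝ) ^ (2 * m + 1)| * (C + 1) with hB
  have hin : ∀ᶠ n in Filter.atTop, ∀ s ∈ Set.uIoc (0 : ℝ) 1, ∀ v ∈ Set.uIoc (-1 : ℝ) 1,
      ‖v ^ (2 * m) * ∑ j ∈ Finset.Icc 1 m, altGamma m j * (j : ℝ) ^ (2 * m + 1) *
        S n ((j : ℝ) * s * v / 2)‖ ≤ B := by
    filter_upwards [hbd] with n hn s hs v hv
    have h1 : ‖∑ j ∈ Finset.Icc 1 m, altGamma m j * (j : ℝ) ^ (2 * m + 1) *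
        S n ((j : ℝ) * s * v / 2)‖ ≤ B := by
      refine (norm_sum_le _ _).trans (Finset.sum_le_sum fun j hj => ?_)
      rw [norm_mul]
      exact mul_le_mul_of_nonneg_left (hn _ (hmem j hj s hs v hv)) (abs_nonneg _)
    rw [norm_mul]
    have h2 : ‖v ^ (2 * m)‖ ≤ 1 := by
      rw [Set.uIoc_of_le (by norm_num)] at hv
      rw [norm_pow]
      exact pow_le_one₀ (norm_nonneg _) (abs_le.2 ⟨hv.1.le, hv.2⟩)
    calc _ ≤ 1 * B := mul_le_mul h2 h1 (norm_nonneg _) zero_le_one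
      _ = B := one_mul _
  unfold altR
  apply intervalIntegral.tendsto_integral_filter_of_dominated_convergence (fun _ => B * 2)
  · refine Filter.Eventually.of_forall fun n => Continuous.aestronglyMeasurable ?_
    refine Continuous.mul (by fun_prop) ?_
    apply intervalIntegral.continuous_parametric_intervalIntegral_of_continuous'
    unfold Function.uncurry
    have := hS n
    fun_prop
  · filter_upwards [hin] with n hn
    refine Filter.Eventually.of_forall fun s hs => ?_
    have h1 := intervalIntegral.norm_integral_le_of_norm_le_const (hn s hs)
    rw [show |(1 : ℝ) - -1| = 2 by norm_num] at h1
    rw [norm_mul]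
    have h2 : ‖(1 - s) ^ (2 * m - 1)‖ ≤ 1 := by
      rw [Set.uIoc_of_le (by norm_num)] at hs
      rw [norm_pow]
      exact pow_le_one₀ (norm_nonneg _) (abs_le.2 ⟨by linarith [hs.2], by linarith [hs.1]⟩)
    calc _ ≤ 1 * (B * 2) := mul_le_mul h2 h1 (norm_nonneg _) zero_le_one
      _ = B * 2 := one_mul _
  · exact intervalIntegrable_const
  · refine Filter.Eventually.of_forall fun s hs => ?_
    refine Filter.Tendsto.const_mul _ ?_
    apply intervalIntegral.tendsto_integral_filter_of_dominated_convergence (fun _ => B)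
    · refine Filter.Eventually.of_forall fun n => Continuous.aestronglyMeasurable ?_
      have := hS n
      fun_prop
    · filter_upwards [hin] with n hn
      exact Filter.Eventually.of_forall fun v hv => hn s hs v hv
    · exact intervalIntegrable_const
    · refine Filter.Eventually.of_forall fun v hv => ?_
      refine Filter.Tendsto.const_mul _ ?_
      refine tendsto_finsetSum _ fun j hj => ?_
      exact (hg.tendsto_at (hmem j hj s hs v hv)).const_mul _

lemma altG_poly_step (m p : ℕ) (hm : 1 ≤ m) (hp : p < 2 * m) (x : ℝ) :
    altG m (fun y => y ^ (p + 1)) (x + 1) - altG m (fun y => y ^ (p + 1)) x = (p + 1) * x ^ p := by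
  rw [altG_step]
  have h := alt_onestep m hm (fun y => (p + 1) * (x + y) ^ p) (fun y => (x + y) ^ (p + 1))
    (by fun_prop) (by
      intro y
      have := ((hasDerivAt_id y).const_add x).pow (p + 1)
      convert! this using 1
      simp)
  have hz : iteratedDeriv (2 * m) (fun y : ℝ => ((p : ℝ) + 1) * (x + y) ^ p) = fun _ => 0 := by
    ext t
    rw [iteratedDeriv_const_mul_field, iteratedDeriv_comp_const_add (2 * m) (fun y : ℝ => y ^ p) x]
    beta_reduce
    rw [iteratedDeriv_pow, Nat.descFactorial_eq_zero_iff_lt.mpr hp]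
    simp
  rw [hz] at h
  simpa [altR, sub_eq_add_neg] using h

lemma altG_poly_eq (m₀ m p : ℕ) (hm₀ : 1 ≤ m₀) (hm : m₀ ≤ m) (hp : p < 2 * m₀) (x : ℝ) :
    altG m (fun y => y ^ p) x = altG m₀ (fun y => y ^ p) x := by
  let Q : ℕ → Polynomial ℝ := fun m => ∑ j ∈ Finset.Icc 1 m, Polynomial.C (altGamma m j) *
    ∑ i ∈ Finset.range j, (Polynomial.X + Polynomial.C (-1 + (j : ℝ) / 2 - i)) ^ (p + 1)
  have hQ : ∀ m x, (Q m).eval x = altG m (fun y => y ^ (p + 1)) x := by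
    intro m x
    simp only [Q, altG, Polynomial.eval_finsetSum, Polynomial.eval_mul, Polynomial.eval_C,
      Polynomial.eval_pow, Polynomial.eval_add, Polynomial.eval_X]
    refine Finset.sum_congr rfl fun j _ => ?_
    congr 1
    refine Finset.sum_congr rfl fun i _ => ?_
    congr 1; ring
  have hQ' : ∀ m x, (Polynomial.derivative (Q m)).eval x = (p + 1) * altG m (fun y => y ^ p) x := by
    intro m x
    simp only [Q, altG, Polynomial.derivative_sum, Polynomial.derivative_C_mul,
      Polynomial.derivative_X_add_C_pow,
      Polynomial.eval_finsetSum, Polynomial.eval_mul, Polynomial.eval_C,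
      Polynomial.eval_pow, Polynomial.eval_add, Polynomial.eval_X, Finset.mul_sum]
    refine Finset.sum_congr rfl fun j _ => ?_
    refine Finset.sum_congr rfl fun i _ => ?_
    simp only [Nat.add_sub_cancel]
    push_cast
    rw [show x + (-1 + (j : ℝ) / 2 - i) = x - 1 + (j : ℝ) / 2 - i by ring]
    ring
  have hn : ∀ n : ℕ, (Q m - Q m₀).eval (n : ℝ) = (Q m - Q m₀).eval 0 := by
    intro n
    induction n with
    | zero => simp
    | succ n ih =>
      rw [← ih]
      have h1 := altG_poly_step m p (by omega) (by omega) n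
      have h2 := altG_poly_step m₀ p (by omega) (by omega) n
      simp only [Polynomial.eval_sub, hQ]
      push_cast
      linarith
  have hD : Q m - Q m₀ = Polynomial.C ((Q m - Q m₀).eval 0) := by
    apply Polynomial.eq_of_infinite_eval_eq
    refine (Set.infinite_range_of_injective (Nat.cast_injective (R := ℝ))).mono ?_
    rintro _ ⟨n, rfl⟩
    simpa using hn n
  have h3 := congrArg (fun P => (Polynomial.derivative P).eval x) hD
  simp only [Polynomial.derivative_sub, Polynomial.eval_sub, hQ', Polynomial.derivative_C,
    Polynomial.eval_zero] at h3
  have : (p + 1 : ℝ) ≠ 0 := by positivity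
  apply mul_left_cancel₀ this
  linarith

lemma altG_expand (m q : ℕ) (F : ℝ → ℝ) (x : ℝ) (a : ℕ → ℝ) (ρ : ℝ → ℝ)
    (h : ∀ u, F (x + u) = ∑ i ∈ Finset.range q, a i * u ^ i + ρ u) :
    altG m F x = ∑ i ∈ Finset.range q, a i * altG m (fun y => y ^ i) 0 + altG m ρ 0 := by
  unfold altG
  simp_rw [Finset.mul_sum]
  rw [Finset.sum_comm, ← Finset.sum_add_distrib]
  refine Finset.sum_congr rfl fun j _ => ?_
  rw [Finset.sum_comm, ← Finset.sum_add_distrib]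
  refine Finset.sum_congr rfl fun i _ => ?_
  rw [show x - 1 + (j : ℝ) / 2 - i = x + (0 - 1 + (j : ℝ) / 2 - i) by ring, h, mul_add,
    Finset.mul_sum]
  congr 1
  refine Finset.sum_congr rfl fun k _ => ?_
  ring

lemma altG_diff_tendsto (m₀ m : ℕ) (hm₀ : 1 ≤ m₀) (hm : m₀ ≤ m)
    (f F : ℝ → ℝ) (hf : ContDiff ℝ (2 * m : ℕ) f) (hF : ∀ x : ℝ, HasDerivAt F (f x) x)
    (hto0 : Filter.Tendsto (iteratedDeriv (2 * m₀ - 1) f) Filter.atTop (nhds 0)) :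
    Filter.Tendsto (fun x : ℝ => altG m F x - altG m₀ F x) Filter.atTop (nhds 0) := by
  obtain ⟨n, hn⟩ : ∃ n, 2 * m₀ = n + 1 := ⟨2 * m₀ - 1, by omega⟩
  have hdF : deriv F = f := funext fun x => (hF x).deriv
  have hFc : ContDiff ℝ (n + 1 : ℕ) F := by
    push_cast
    rw [contDiff_succ_iff_deriv]
    refine ⟨fun x => (hF x).differentiableAt, by simp, ?_⟩
    rw [hdF]
    exact hf.of_le (by exact_mod_cast (show n ≤ 2 * m by omega))
  have hto : Filter.Tendsto (iteratedDeriv (n + 1) F) Filter.atTop (nhds 0) := by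
    rw [iteratedDeriv_succ', hdF]
    rwa [show 2 * m₀ - 1 = n by omega] at hto0
  let ρ : ℝ → ℝ → ℝ := fun x u => u ^ (n + 1) / (n.factorial : ℝ) *
        ∫ s in (0 : ℝ)..1, (1 - s) ^ n * iteratedDeriv (n + 1) F (x + s * u)
  have hρ : ∀ x u, F (x + u) = ∑ i ∈ Finset.range (n + 1),
      iteratedDeriv i F x / (i.factorial : ℝ) * u ^ i + ρ x u := by
    intro x u
    have := taylor01 n (fun y => F (x + y)) (by fun_prop) u
    simp only [iteratedDeriv_comp_const_add, add_zero] at this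
    exact this
  have hlim : ∀ u, Filter.Tendsto (fun x => ρ x u) Filter.atTop (nhds 0) := by
    intro u
    have : Filter.Tendsto (fun x => ∫ s in (0 : ℝ)..1, (1 - s) ^ n * iteratedDeriv (n + 1) F (x + s * u))
        Filter.atTop (nhds 0) := by
      rw [Metric.tendsto_atTop] at hto ⊢
      intro ε hε
      obtain ⟨N, hN⟩ := hto (ε / 2) (by positivity)
      refine ⟨N + |u|, fun x hx => ?_⟩
      have h1 : ∀ s ∈ Set.uIoc (0 : ℝ) 1, ‖(1 - s) ^ n * iteratedDeriv (n + 1) F (x + s * u)‖ ≤ ε / 2 := by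
        intro s hs
        rw [Set.uIoc_of_le (by norm_num)] at hs
        have hsu : |s * u| ≤ |u| := by
          rw [abs_mul, abs_of_nonneg hs.1.le]
          exact mul_le_of_le_one_left (abs_nonneg _) hs.2
        have h2 := hN (x + s * u) (by linarith [(abs_le.1 hsu).1])
        rw [dist_zero_right] at h2
        rw [norm_mul]
        have h3 : ‖(1 - s) ^ n‖ ≤ 1 := by
          rw [norm_pow]
          exact pow_le_one₀ (norm_nonneg _) (abs_le.2 ⟨by linarith [hs.2], by linarith [hs.1]⟩)
        calc _ ≤ 1 * (ε / 2) := mul_le_mul h3 h2.le (norm_nonneg _) zero_le_one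
          _ = ε / 2 := one_mul _
      have h4 := intervalIntegral.norm_integral_le_of_norm_le_const h1
      rw [dist_zero_right]
      simp at h4
      simp
      linarith
    simpa [ρ] using this.const_mul (u ^ (n + 1) / (n.factorial : ℝ))
  have hG : ∀ m, Filter.Tendsto (fun x => altG m (ρ x) 0) Filter.atTop (nhds 0) := by
    intro m
    unfold altG
    have : Filter.Tendsto (fun x => ∑ j ∈ Finset.Icc 1 m, altGamma m j *
      ∑ i ∈ Finset.range j, ρ x (0 - 1 + (j : ℝ) / 2 - (i : ℝ))) Filter.atTop
      (nhds (∑ j ∈ Finset.Icc 1 m, altGamma m j * ∑ i ∈ Finset.range j, 0)) :=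
      tendsto_finsetSum _ fun j _ => (tendsto_finsetSum _ fun i _ => hlim _).const_mul _
    simpa using this
  have := (hG m).sub (hG m₀)
  rw [sub_zero] at this
  refine this.congr fun x => ?_
  rw [altG_expand m _ F x _ _ (hρ x), altG_expand m₀ _ F x _ _ (hρ x)]
  have : ∀ i ∈ Finset.range (n + 1), iteratedDeriv i F x / (i.factorial : ℝ) * altG m (fun y => y ^ i) 0 =
      iteratedDeriv i F x / (i.factorial : ℝ) * altG m₀ (fun y => y ^ i) 0 := by
    intro i hi
    rw [altG_poly_eq m₀ m i hm₀ hm (by rw [Finset.mem_range] at hi; omega)]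
  rw [Finset.sum_congr rfl this]
  ring

/-- Summing (possibly divergent) series by the Alt formula: if `f^{(2m₀−1)}(x) → 0` as
`x → ∞` and the series `∑_{k≥0} f^{(2m)}(k+w)` converges uniformly in `w ∈ [−m/2, m/2]`
(to a function `g`), then `∑_{k=0}^{n−1} f(k) − G_{m₀,F}(n)` converges as `n → ∞` to
`−G_{m,F}(0) − R_{m,f}(∞)`. -/
theorem alt_generalized_sum (m₀ m : ℕ) (hm₀ : 1 ≤ m₀) (hm : m₀ ≤ m)
    (f F : ℝ → ℝ) (hf : ContDiff ℝ (2 * m) f) (hF : ∀ x : ℝ, HasDerivAt F (f x) x)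
    (hto0 : Filter.Tendsto (iteratedDeriv (2 * m₀ - 1) f) Filter.atTop (nhds 0))
    (g : ℝ → ℝ)
    (hg : TendstoUniformlyOn
      (fun (N : ℕ) (w : ℝ) => ∑ k ∈ Finset.range N, iteratedDeriv (2 * m) f ((k : ℝ) + w))
      g Filter.atTop (Set.Icc (-(m : ℝ) / 2) ((m : ℝ) / 2))) :
    Filter.Tendsto
      (fun n : ℕ => ∑ k ∈ Finset.range n, f k - altG m₀ F (n : ℝ))
      Filter.atTop
      (nhds (-(altG m F 0) -
        1 / (((2 * m - 1).factorial : ℝ) * 2 ^ (2 * m + 1)) *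
          ∫ s in (0 : ℝ)..1, (1 - s) ^ (2 * m - 1) *
            ∫ v in (-1 : ℝ)..1, v ^ (2 * m) *
              ∑ j ∈ Finset.Icc 1 m, altGamma m j * (j : ℝ) ^ (2 * m + 1) *
                g ((j : ℝ) * s * v / 2))) := by
  have hf' : ContDiff ℝ (2 * m : ℕ) f := by exact_mod_cast hf
  have hc : Continuous (iteratedDeriv (2 * m) f) := hf'.continuous_iteratedDeriv _ le_rfl
  have hR := altR_tendsto m
    (fun (N : ℕ) (w : ℝ) => ∑ k ∈ Finset.range N, iteratedDeriv (2 * m) f ((k : ℝ) + w))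
    (fun n => by fun_prop) g hg
  have hD := (altG_diff_tendsto m₀ m hm₀ hm f F hf' hF hto0).comp
    (tendsto_natCast_atTop_atTop (R := ℝ))
  have key : ∀ n : ℕ, altG m F n - altG m F 0 = ∑ k ∈ Finset.range n, f k +
      1 / (((2 * m - 1).factorial : ℝ) * 2 ^ (2 * m + 1)) *
      altR m (fun w : ℝ => ∑ k ∈ Finset.range n, iteratedDeriv (2 * m) f ((k : ℝ) + w)) := by
    intro n
    have h1 := alt_onestep m (by omega) (fun w => ∑ k ∈ Finset.range n, f ((k : ℝ) + w))
      (fun w => ∑ k ∈ Finset.range n, F ((k : ℝ) + w)) (by fun_prop)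
      (fun x => HasDerivAt.fun_sum fun k _ => (hF _).comp_const_add (k : ℝ) x)
    have h2 : iteratedDeriv (2 * m) (fun w => ∑ k ∈ Finset.range n, f ((k : ℝ) + w)) =
        fun w : ℝ => ∑ k ∈ Finset.range n, iteratedDeriv (2 * m) f ((k : ℝ) + w) := by
      ext w
      rw [iteratedDeriv_fun_sum]
      · simp only [iteratedDeriv_comp_const_add]
      · intro k _
        apply ContDiff.contDiffAt
        fun_prop
    rw [h2] at h1
    simp only [add_zero] at h1
    rw [← h1]
    have h3 := Finset.sum_range_sub (fun k : ℕ => altG m F k) n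
    simp only [Nat.cast_zero] at h3
    rw [← h3]
    simp only [Nat.cast_add, Nat.cast_one, altG_step]
    rw [Finset.sum_comm]
    refine Finset.sum_congr rfl fun j _ => ?_
    rw [← Finset.mul_sum, Finset.sum_sub_distrib]
    simp only [sub_eq_add_neg]
  have hfin := ((hR.const_mul (1 / (((2 * m - 1).factorial : ℝ) * 2 ^ (2 * m + 1)))).const_sub
    (-(altG m F 0))).add hD
  rw [add_zero] at hfin
  refine hfin.congr fun n => ?_
  have := key n
  simp only [Function.comp]
  linarith
end

section
/- Let m₀ ≥ 1 and m ≥ m₀ be integers, let f : ℝ → ℝ be 2m-times continuously differentiable with antiderivative F, and suppose that: f^{(2m₀−1)}(x) → 0 as x → ∞; the series ∑_{k=0}^{∞} f^{(2m)}(k+w) converges uniformly in w ∈ [−m/2, m/2]; f^{(2j−1)}(x) → 0 as x → ∞ for every j = m₀, …, m−1; and ∫_0^{∞} |f^{(2m−1)}(x)| dx < ∞. Then G_{m₀,F}(n) − G^EM_{m₀,F}(n) → 0 as n → ∞, and consequently the two generalized sums coincide: lim_{n→∞} ( ∑_{k=0}^{n−1} f(k) − G_{m₀,F}(n) ) = lim_{n→∞}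 ( ∑_{k=0}^{n−1} f(k) − G^EM_{m₀,F}(n) ). -/
open MeasureTheory

/-- `G^EM_{m,F}(x) := F(x−1) + F′(x−1)/2 + ∑_{j=1}^{m−1} (B_{2j}/(2j)!)·F^{(2j)}(x−1)`,
where `B_k` is the `k`-th Bernoulli number (`B₁ = −1/2`). -/
noncomputable def emG (m : ℕ) (F : ℝ → ℝ) (x : ℝ) : ℝ :=
  F (x - 1) + deriv F (x - 1) / 2 +
    ∑ j ∈ Finset.Icc 1 (m - 1),
      ((bernoulli (2 * j) : ℚ) : ℝ) / ((2 * j).factorial : ℝ) * iteratedDeriv (2 * j) F (x - 1)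

theorem aux_sum_Icc (m : ℕ) (f : ℕ → ℝ) :
    ∑ j ∈ Finset.Icc 1 m, f j = ∑ j ∈ Finset.range m, f (j + 1) := by
  induction m with
  | zero => simp
  | succ n ih => rw [Finset.sum_Icc_succ_top (by omega), ih, Finset.sum_range_succ]

theorem aux_alt (m e : ℕ) (he : Even e) (hlt : e < 2 * m) :
    (((2 * m).choose m : ℝ)) * 0 ^ e +
      2 * ∑ j ∈ Finset.Icc 1 m, (-1 : ℝ) ^ j * (j : ℝ) ^ e * ((2 * m).choose (m + j) : ℝ) = 0 := by
  have h0 := congrFun (fwdDiff_iter_pow_eq_zero_of_lt (R := ℝ) hlt) (-(m : ℝ))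
  rw [fwdDiff_iter_eq_sum_shift] at h0
  have h1 : ∑ k ∈ Finset.range (m + (m + 1)),
      (-1 : ℝ) ^ (2 * m - k) * ((2 * m).choose k : ℝ) * (-(m : ℝ) + k) ^ e = 0 := by
    rw [show m + (m + 1) = 2 * m + 1 by ring]
    simpa [zsmul_eq_mul] using h0
  rw [Finset.sum_range_add, Finset.sum_range_succ', ← Finset.sum_range_reflect] at h1
  have h2 : ∀ j ∈ Finset.range m,
      (-1 : ℝ) ^ (2 * m - (m - 1 - j)) * ((2 * m).choose (m - 1 - j) : ℝ)
        * (-(m : ℝ) + ((m - 1 - j : ℕ) : ℝ)) ^ e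
      = (-1 : ℝ) ^ m * ((-1 : ℝ) ^ (j + 1) * ((j + 1 : ℕ) : ℝ) ^ e
        * ((2 * m).choose (m + (j + 1)) : ℝ)) := by
    intro j hj
    have hj := Finset.mem_range.1 hj
    obtain ⟨r, rfl⟩ : ∃ r, m = r + (j + 1) := ⟨m - (j + 1), by omega⟩
    have e1 : r + (j + 1) - 1 - j = r := by omega
    rw [e1, show 2 * (r + (j + 1)) - r = (r + (j + 1)) + (j + 1) by omega,
      Nat.choose_symm_of_eq_add (show 2 * (r + (j + 1)) = r + (r + (j + 1) + (j + 1)) by ring),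
      show (-((r + (j + 1) : ℕ) : ℝ) + (r : ℝ)) = -((j + 1 : ℕ) : ℝ) by push_cast; ring,
      he.neg_pow, pow_add]
    ring
  have h3 : ∀ j ∈ Finset.range m,
      (-1 : ℝ) ^ (2 * m - (m + (j + 1))) * ((2 * m).choose (m + (j + 1)) : ℝ)
        * (-(m : ℝ) + ((m + (j + 1) : ℕ) : ℝ)) ^ e
      = (-1 : ℝ) ^ m * ((-1 : ℝ) ^ (j + 1) * ((j + 1 : ℕ) : ℝ) ^ e
        * ((2 * m).choose (m + (j + 1)) : ℝ)) := by
    intro j hj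
    have hj := Finset.mem_range.1 hj
    obtain ⟨r, rfl⟩ : ∃ r, m = r + (j + 1) := ⟨m - (j + 1), by omega⟩
    rw [show 2 * (r + (j + 1)) - (r + (j + 1) + (j + 1)) = r by omega,
      show (-((r + (j + 1) : ℕ) : ℝ) + ((r + (j + 1) + (j + 1) : ℕ) : ℝ)) = ((j + 1 : ℕ) : ℝ) by
        push_cast; ring, pow_add (-1 : ℝ) r]
    have : (-1 : ℝ) ^ (j + 1) * (-1 : ℝ) ^ (j + 1) = 1 := by
      rw [← mul_pow]; simp
    linear_combination (-(-1 : ℝ) ^ r * ((j + 1 : ℕ) : ℝ) ^ e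
        * ((2 * (r + (j + 1))).choose (r + (j + 1) + (j + 1)) : ℝ)) * this
  rw [Finset.sum_congr rfl h2, Finset.sum_congr rfl h3, ← Finset.mul_sum,
    show 2 * m - (m + 0) = m by omega] at h1
  simp only [add_zero, neg_add_cancel] at h1
  rw [aux_sum_Icc]
  have hne : (-1 : ℝ) ^ m ≠ 0 := by positivity
  apply mul_left_cancel₀ hne
  linear_combination h1

theorem aux_gamma (m k : ℕ) (hk : k ≤ 2 * m) :
    ∑ j ∈ Finset.Icc 1 m, altGamma m j * (((j : ℝ) / 2) ^ k - (-((j : ℝ) / 2)) ^ k)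
      = if k = 1 then 1 else 0 := by
  rcases Nat.even_or_odd k with h | h
  · rw [if_neg (by rintro rfl; exact absurd h (by decide))]
    simp [h.neg_pow]
  · obtain ⟨e, rfl⟩ : ∃ e, k = e + 1 := ⟨k - 1, by have := h.pos; omega⟩
    have he : Even e := by
      rcases Nat.even_or_odd e with h' | h'
      · exact h'
      · exact absurd h (by simpa using h'.add_one)
    have H := aux_alt m e he (by omega)
    have hc : ((2 * m).choose m : ℝ) ≠ 0 := by
      exact_mod_cast (Nat.choose_pos (by omega)).ne'
    have : ∀ j ∈ Finset.Icc 1 m,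
        altGamma m j * (((j : ℝ) / 2) ^ (e + 1) - (-((j : ℝ) / 2)) ^ (e + 1))
        = (-(2 / 2 ^ e) / ((2 * m).choose m : ℝ)) *
          ((-1 : ℝ) ^ j * (j : ℝ) ^ e * ((2 * m).choose (m + j) : ℝ)) := by
      intro j hj
      have hj := (Finset.mem_Icc.1 hj).1
      obtain ⟨i, rfl⟩ : ∃ i, j = i + 1 := ⟨j - 1, by omega⟩
      rw [h.neg_pow, altGamma, Nat.add_sub_cancel, div_pow]
      have : ((i + 1 : ℕ) : ℝ) ≠ 0 := by positivity
      field_simp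
      ring
    rw [Finset.sum_congr rfl this, ← Finset.mul_sum]
    rcases Nat.eq_zero_or_pos e with rfl | hp
    · simp only [pow_zero, mul_one] at H ⊢
      simp only [if_true]
      field_simp
      linarith
    · rw [zero_pow hp.ne'] at H
      rw [if_neg (by omega)]
      have : ∑ j ∈ Finset.Icc 1 m, (-1 : ℝ) ^ j * (j : ℝ) ^ e * ((2 * m).choose (m + j) : ℝ) = 0 := by
        linarith
      rw [this, mul_zero]

noncomputable def auxMu (m k : ℕ) : ℝ :=
  ∑ j ∈ Finset.Icc 1 m, altGamma m j * ∑ i ∈ Finset.range j, ((j : ℝ) / 2 - (i : ℝ)) ^ k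

theorem aux_mu_rec (m n : ℕ) (hn : n ≤ 2 * m) :
    ∑ k ∈ Finset.range n, (n.choose k : ℝ) * auxMu m k = n := by
  have hA : ∀ x : ℝ, ∑ k ∈ Finset.range n, (n.choose k : ℝ) * x ^ k = (x + 1) ^ n - x ^ n := by
    intro x
    rw [add_pow, Finset.sum_range_succ]
    simp [mul_comm]
  have hB : ∀ x : ℝ, (x + 1) ^ n = ∑ k ∈ Finset.range (n + 1), (n.choose k : ℝ) * x ^ k := by
    intro x
    rw [add_pow]
    simp [mul_comm]
  calc ∑ k ∈ Finset.range n, (n.choose k : ℝ) * auxMu m k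
      = ∑ j ∈ Finset.Icc 1 m, altGamma m j * ∑ i ∈ Finset.range j,
          ∑ k ∈ Finset.range n, (n.choose k : ℝ) * ((j : ℝ) / 2 - (i : ℝ)) ^ k := by
        simp only [auxMu, Finset.mul_sum]
        rw [Finset.sum_comm]
        refine Finset.sum_congr rfl fun j _ => ?_
        rw [Finset.sum_comm]
        refine Finset.sum_congr rfl fun i _ => Finset.sum_congr rfl fun k _ => ?_
        ring
    _ = ∑ j ∈ Finset.Icc 1 m, altGamma m j *
          (((j : ℝ) / 2 + 1) ^ n - (-((j : ℝ) / 2) + 1) ^ n) := by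
        refine Finset.sum_congr rfl fun j _ => ?_
        congr 1
        have := Finset.sum_range_sub' (fun i : ℕ => ((j : ℝ) / 2 - (i : ℝ) + 1) ^ n) j
        simp only [hA]
        convert! this using 1
        · refine Finset.sum_congr rfl fun i _ => ?_
          push_cast
          ring
        · simp only [Nat.cast_zero, sub_zero]
          congr 2
          ring
    _ = ∑ k ∈ Finset.range (n + 1), (n.choose k : ℝ) *
          ∑ j ∈ Finset.Icc 1 m, altGamma m j * (((j : ℝ) / 2) ^ k - (-((j : ℝ) / 2)) ^ k) := by
        simp only [hB, Finset.mul_sum, ← Finset.sum_sub_distrib]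
        rw [Finset.sum_comm]
        refine Finset.sum_congr rfl fun j _ => Finset.sum_congr rfl fun i _ => ?_
        ring
    _ = n := by
        rw [Finset.sum_congr rfl (fun k hk => by
          rw [aux_gamma m k (by have := Finset.mem_range.1 hk; omega)])]
        simp
        rintro rfl
        simp

theorem aux_mu (m k : ℕ) (hk : k < 2 * m) : auxMu m k = ((bernoulli' k : ℚ) : ℝ) := by
  induction k using Nat.strong_induction_on with
  | _ k ih =>
    have h1 := aux_mu_rec m (k + 1) (by omega)
    have h2 : ∑ i ∈ Finset.range (k + 1), ((k + 1).choose i : ℝ) * ((bernoulli' i : ℚ) : ℝ)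
        = ((k + 1 : ℕ) : ℝ) := by
      exact_mod_cast sum_bernoulli' (k + 1)
    rw [Finset.sum_range_succ] at h1 h2
    rw [Finset.sum_congr rfl (fun i hi => by
      rw [ih i (Finset.mem_range.1 hi) (by have := Finset.mem_range.1 hi; omega)])] at h1
    have hc : (((k + 1).choose k : ℕ) : ℝ) ≠ 0 := by simp; positivity
    apply mul_left_cancel₀ hc
    linarith

theorem aux_taylor (K : ℕ) (F : ℝ → ℝ) (hF : ContDiff ℝ ((K + 1 : ℕ) : WithTop ℕ∞) F)
    (h0 : Filter.Tendsto (iteratedDeriv (K + 1) F) Filter.atTop (nhds 0)) (t : ℝ) :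
    Filter.Tendsto (fun x => F (x + t) -
      ∑ k ∈ Finset.range (K + 1), iteratedDeriv k F x / (k.factorial : ℝ) * t ^ k)
      Filter.atTop (nhds 0) := by
  rcases eq_or_ne t 0 with rfl | ht
  · have : ∀ x, F (x + 0) -
      ∑ k ∈ Finset.range (K + 1), iteratedDeriv k F x / (k.factorial : ℝ) * 0 ^ k = 0 := by
      intro x
      rw [Finset.sum_range_succ']
      simp
    simp only [this]
    exact tendsto_const_nhds
  have key : ∀ x, ∃ y ∈ Set.uIoo x (x + t), F (x + t) -
      ∑ k ∈ Finset.range (K + 1), iteratedDeriv k F x / (k.factorial : ℝ) * t ^ k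
      = iteratedDeriv (K + 1) F y * t ^ (K + 1) / ((K + 1).factorial : ℝ) := by
    intro x
    have hx : x ≠ x + t := by simpa using ht
    obtain ⟨y, hy, h⟩ := taylor_mean_remainder_lagrange_iteratedDeriv (n := K) (f := F) hx
      (by exact_mod_cast hF.contDiffOn)
    refine ⟨y, hy, ?_⟩
    rw [taylor_within_apply, add_sub_cancel_left] at h
    rw [← h]
    congr 1
    refine Finset.sum_congr rfl fun k hk => ?_
    rw [iteratedDerivWithin_eq_iteratedDeriv (uniqueDiffOn_uIcc hx)
      ((hF.of_le (by
        have := Finset.mem_range.1 hk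
        exact_mod_cast this.le)).contDiffAt) Set.left_mem_uIcc, smul_eq_mul]
    ring
  choose y hy h using key
  have hyt : Filter.Tendsto y Filter.atTop Filter.atTop := by
    apply Filter.tendsto_atTop_mono (f := fun x => x + (-|t|))
    · intro x
      have := (hy x).1
      rcases le_total t 0 with h' | h'
      · rw [abs_of_nonpos h']
        have : x ⊓ (x + t) = x + t := by simp [h']
        linarith
      · rw [abs_of_nonneg h']
        have : x ⊓ (x + t) = x := by simp [h']
        linarith
    · exact Filter.tendsto_atTop_add_const_right _ _ Filter.tendsto_id
  simp only [h]
  have := ((h0.comp hyt).mul_const (t ^ (K + 1))).div_const ((K + 1).factorial : ℝ)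
  simpa using this

theorem aux_emG (m : ℕ) (hm : 1 ≤ m) (F : ℝ → ℝ) (x : ℝ) :
    emG m F x = ∑ k ∈ Finset.range (2 * m),
      iteratedDeriv k F (x - 1) / (k.factorial : ℝ) * ((bernoulli' k : ℚ) : ℝ) := by
  induction m, hm using Nat.le_induction with
  | base =>
    simp [emG, Finset.sum_range_succ, iteratedDeriv_one]
    ring
  | succ n hn ih =>
    have : emG (n + 1) F x = emG n F x + ((bernoulli (2 * n) : ℚ) : ℝ)
        / ((2 * n).factorial : ℝ) * iteratedDeriv (2 * n) F (x - 1) := by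
      obtain ⟨r, rfl⟩ : ∃ r, n = r + 1 := ⟨n - 1, by omega⟩
      simp only [emG, Nat.add_sub_cancel]
      rw [Finset.sum_Icc_succ_top (by omega)]
      ring
    rw [this, ih, show 2 * (n + 1) = 2 * n + 1 + 1 by ring, Finset.sum_range_succ,
      Finset.sum_range_succ, bernoulli'_eq_zero_of_odd (n := 2 * n + 1) ⟨n, rfl⟩ (by omega),
      bernoulli_eq_bernoulli'_of_ne_one (by omega)]
    simp
    ring

theorem aux_diff (m : ℕ) (hm : 1 ≤ m) (F : ℝ → ℝ) (x : ℝ) :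
    altG m F x - emG m F x = ∑ j ∈ Finset.Icc 1 m, altGamma m j *
      ∑ i ∈ Finset.range j, (F (x - 1 + ((j : ℝ) / 2 - (i : ℝ))) -
        ∑ k ∈ Finset.range (2 * m), iteratedDeriv k F (x - 1) / (k.factorial : ℝ)
          * ((j : ℝ) / 2 - (i : ℝ)) ^ k) := by
  have : ∑ k ∈ Finset.range (2 * m),
      iteratedDeriv k F (x - 1) / (k.factorial : ℝ) * ((bernoulli' k : ℚ) : ℝ)
      = ∑ j ∈ Finset.Icc 1 m, altGamma m j *
        ∑ i ∈ Finset.range j, 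
        ∑ k ∈ Finset.range (2 * m), iteratedDeriv k F (x - 1) / (k.factorial : ℝ)
          * ((j : ℝ) / 2 - (i : ℝ)) ^ k := by
    rw [Finset.sum_congr rfl (fun k hk => by rw [← aux_mu m k (Finset.mem_range.1 hk)])]
    simp only [auxMu, Finset.mul_sum]
    rw [Finset.sum_comm]
    refine Finset.sum_congr rfl fun j _ => ?_
    rw [Finset.sum_comm]
    refine Finset.sum_congr rfl fun i _ => Finset.sum_congr rfl fun k _ => ?_
    ring
  rw [aux_emG m hm, this, altG, ← Finset.sum_sub_distrib]
  refine Finset.sum_congr rfl fun j _ => ?_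
  rw [← mul_sub, ← Finset.sum_sub_distrib]
  simp only [add_sub_assoc]

/-- Under the combined hypotheses of the Alt and EM summation propositions, the two
centering terms are asymptotically interchangeable, `G_{m₀,F}(n) − G^EM_{m₀,F}(n) → 0`,
and consequently the Alt and EM generalized sums coincide. -/
theorem alt_em_centering_interchangeable (m₀ m : ℕ) (hm₀ : 1 ≤ m₀) (hm : m₀ ≤ m)
    (f F : ℝ → ℝ) (hf : ContDiff ℝ (2 * m) f) (hF : ∀ x : ℝ, HasDerivAt F (f x) x)
    (hto0Alt : Filter.Tendsto (iteratedDeriv (2 * m₀ - 1) f) Filter.atTop (nhds 0))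
    (g : ℝ → ℝ)
    (hg : TendstoUniformlyOn
      (fun (N : ℕ) (w : ℝ) => ∑ k ∈ Finset.range N, iteratedDeriv (2 * m) f ((k : ℝ) + w))
      g Filter.atTop (Set.Icc (-(m : ℝ) / 2) ((m : ℝ) / 2)))
    (hto0EM : ∀ j : ℕ, m₀ ≤ j → j ≤ m - 1 →
      Filter.Tendsto (iteratedDeriv (2 * j - 1) f) Filter.atTop (nhds 0))
    (hint : IntegrableOn (iteratedDeriv (2 * m - 1) f) (Set.Ici (0 : ℝ))) :
    Filter.Tendsto (fun n : ℕ => altG m₀ F (n : ℝ) - emG m₀ F (n : ℝ))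
      Filter.atTop (nhds 0) ∧
    ∀ L : ℝ,
      Filter.Tendsto (fun n : ℕ => ∑ k ∈ Finset.range n, f k - altG m₀ F (n : ℝ))
          Filter.atTop (nhds L) ↔
        Filter.Tendsto (fun n : ℕ => ∑ k ∈ Finset.range n, f k - emG m₀ F (n : ℝ))
          Filter.atTop (nhds L) := by
  have hd : deriv F = f := funext fun x => (hF x).deriv
  have hFs : ContDiff ℝ ((2 * m₀ - 1 + 1 : ℕ) : WithTop ℕ∞) F := by
    have : ContDiff ℝ ((2 * m : ℕ) + 1 : WithTop ℕ∞) F := by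
      rw [contDiff_succ_iff_deriv]
      refine ⟨fun x => (hF x).differentiableAt, fun h => ?_, ?_⟩
      · exact absurd h (by exact_mod_cast WithTop.natCast_ne_top (α := ℕ∞) (2 * m))
      rw [hd]
      exact_mod_cast hf
    refine this.of_le ?_
    have h2 : 2 * m₀ - 1 + 1 ≤ 2 * m + 1 := by omega
    have h3 : ((2 * m₀ - 1 + 1 : ℕ) : WithTop ℕ∞) ≤ ((2 * m + 1 : ℕ) : WithTop ℕ∞) :=
      Nat.mono_cast h2
    rw [Nat.cast_succ (2 * m)] at h3
    exact h3
  have hmain : Filter.Tendsto (fun n : ℕ => altG m₀ F (n : ℝ) - emG m₀ F (n : ℝ))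
      Filter.atTop (nhds 0) := by
    have hT := aux_taylor (2 * m₀ - 1) F hFs (by rw [iteratedDeriv_succ', hd]; exact hto0Alt)
    rw [show 2 * m₀ - 1 + 1 = 2 * m₀ by omega] at hT
    have hn : Filter.Tendsto (fun n : ℕ => (n : ℝ) - 1) Filter.atTop Filter.atTop :=
      Filter.tendsto_atTop_add_const_right _ (-1) tendsto_natCast_atTop_atTop
    simp only [aux_diff m₀ hm₀]
    rw [show (0 : ℝ) = ∑ j ∈ Finset.Icc 1 m₀, altGamma m₀ j * ∑ i ∈ Finset.range j, (0 : ℝ) by simp]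
    refine tendsto_finsetSum _ fun j _ => Filter.Tendsto.const_mul _ ?_
    refine tendsto_finsetSum _ fun i _ => ?_
    exact (hT _).comp hn
  refine ⟨hmain, fun L => ⟨fun h => ?_, fun h => ?_⟩⟩
  · have := h.add hmain
    rw [add_zero] at this
    exact this.congr fun n => by ring
  · have := h.sub hmain
    rw [sub_zero] at this
    exact this.congr fun n => by ring
end
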